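/- Assume char k = 0. Let f = x_1^{m_1}⋯x_n^{m_n} ∈ R = k[x_1,…,x_n] be a nonconstant monomial and I = ⟨f⟩. For s ∈ ℕ, the minimal primes of the ideal of s-jets J_s(I) are exactly the ideals P_p = ⟨x_{i,j} : 1 ≤ i ≤ n, 0 ≤ j ≤ p_i − 1⟩, where p = (p_1,…,p_n) ranges over the tuples of nonnegative integers satisfying Σ_{i=1}^n m_i p_i ≥ s + 1 that are minimal with respect to componentwise order among tuples with this property. -/

import Mathlib

open MvPolynomial

/-- The substitution `xᵢ ↦ Σ_{j=0}^s x_{i,j} tʲ` taking a polynomial in the variables `σ`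
to a polynomial in `t` with coefficients in the jet polynomial ring `k[x_{i,j}]`. -/
noncomputable def jetSub (k : Type*) [Field k] {σ : Type*} (s : ℕ) :
    MvPolynomial σ k →ₐ[k] Polynomial (MvPolynomial (σ × Fin (s + 1)) k) :=
  MvPolynomial.aeval fun i =>
    ∑ j : Fin (s + 1), Polynomial.C (MvPolynomial.X (i, j)) * Polynomial.X ^ (j : ℕ)

/-- The `j`-th jet coefficient `f_j` of `f`. -/
noncomputable def jetCoeff (k : Type*) [Field k] {σ : Type*} (s : ℕ)
    (f : MvPolynomial σ k) (j : ℕ) : MvPolynomial (σ × Fin (s + 1)) k :=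
  (jetSub k s f).coeff j

/-- The ideal of `s`-jets generated by the jet coefficients of a set of generators `F`. -/
noncomputable def jetIdeal (k : Type*) [Field k] {σ : Type*} (s : ℕ)
    (F : Set (MvPolynomial σ k)) : Ideal (MvPolynomial (σ × Fin (s + 1)) k) :=
  Ideal.span {g | ∃ f ∈ F, ∃ j ≤ s, g = jetCoeff k s f j}

theorem MvPolynomial.isPrime_span_X_image {σ R : Type*} [CommRing R] [IsDomain R] (S : Set σ) :
    (Ideal.span (X '' S : Set (MvPolynomial σ R))).IsPrime := by
  classical
  let φ : MvPolynomial σ R →ₐ[R] MvPolynomial σ R := aeval fun v => if v ∈ S then 0 else X v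
  have hφ : (Ideal.Quotient.mkₐ R (Ideal.span (X '' S : Set (MvPolynomial σ R)))).comp φ =
      Ideal.Quotient.mkₐ R _ := by
    refine MvPolynomial.algHom_ext fun v => ?_
    by_cases hv : v ∈ S
    · have : (X v : MvPolynomial σ R) ∈ Ideal.span (X '' S : Set (MvPolynomial σ R)) :=
        Ideal.subset_span ⟨v, hv, rfl⟩
      simpa [φ, hv] using (Ideal.Quotient.eq_zero_iff_mem.mpr this).symm
    · simp [φ, hv]
  have hker : Ideal.span (X '' S : Set (MvPolynomial σ R)) = RingHom.ker φ := by
    apply le_antisymm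
    · rw [Ideal.span_le]
      rintro _ ⟨v, hv, rfl⟩
      simp [φ, hv]
    · intro f hf
      have h := DFunLike.congr_fun hφ f
      rw [AlgHom.comp_apply, (RingHom.mem_ker.mp hf), map_zero] at h
      exact Ideal.Quotient.eq_zero_iff_mem.mp h.symm
  rw [hker]
  exact RingHom.ker_isPrime φ

theorem pow_dvd_prod_pow_of_forall_pow_dvd {α ι : Type*} [CommMonoid α] [Fintype ι] {x : α}
    {g : ι → α} {m p : ι → ℕ} {N : ℕ} (hp : N ≤ ∑ i, m i * p i) (h : ∀ i, x ^ p i ∣ g i) :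
    x ^ N ∣ ∏ i, g i ^ m i := by
  refine (pow_dvd_pow _ hp).trans ?_
  rw [← Finset.prod_pow_eq_pow_sum]
  refine Finset.prod_dvd_prod_of_dvd _ _ fun i _ => ?_
  rw [mul_comm, pow_mul]
  exact pow_dvd_pow_of_dvd (h i) _

/-- If a power of a prime divides a product of powers, the exponent is a combination of exponents
of powers dividing the individual factors. -/
theorem Prime.exists_pow_dvd_of_pow_dvd_prod_pow {α ι : Type*} [CommMonoidWithZero α]
    [IsCancelMulZero α] [Fintype ι] {x : α} (hx : Prime x) {g : ι → α} {m : ι → ℕ} {N : ℕ}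
    (h : x ^ N ∣ ∏ i, g i ^ m i) :
    ∃ p : ι → ℕ, N ≤ ∑ i, m i * p i ∧ ∀ i, x ^ p i ∣ g i := by
  classical
  by_cases hfin : ∀ i, m i ≠ 0 → FiniteMultiplicity x (g i)
  · refine ⟨fun i => multiplicity x (g i), ?_, fun i => pow_multiplicity_dvd x (g i)⟩
    rw [pow_dvd_iff_le_emultiplicity, Finset.emultiplicity_prod hx] at h
    have : ∑ i, emultiplicity x (g i ^ m i) = ((∑ i, m i * multiplicity x (g i) : ℕ) : ℕ∞) := by
      rw [Nat.cast_sum]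
      refine Finset.sum_congr rfl fun i _ => ?_
      rw [emultiplicity_pow hx]
      by_cases hi : m i = 0
      · simp [hi]
      · rw [(hfin i hi).emultiplicity_eq_multiplicity, Nat.cast_mul]
    rw [this] at h
    exact_mod_cast h
  · push Not at hfin
    obtain ⟨i, hi, hinf⟩ := hfin
    refine ⟨Pi.single i N, ?_, fun j => ?_⟩
    · refine le_trans ?_ (Finset.single_le_sum (fun _ _ => Nat.zero_le _) (Finset.mem_univ i))
      simpa using Nat.le_mul_of_pos_left N (Nat.pos_of_ne_zero hi)
    · rcases eq_or_ne j i with rfl | hj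
      · cases N with
        | zero => simp
        | succ N => simpa using hinf N
      · simp [hj]

section Jets

variable {k : Type*} [Field k] {σ : Type*} {s : ℕ}

theorem coeff_jetSub_X (i : σ) (d : ℕ) :
    (jetSub k s (X i)).coeff d =
      if h : d < s + 1 then (X (i, ⟨d, h⟩) : MvPolynomial (σ × Fin (s + 1)) k) else 0 := by
  rw [jetSub, aeval_X, Polynomial.finsetSum_coeff]
  simp only [Polynomial.coeff_C_mul, Polynomial.coeff_X_pow, mul_ite, mul_one, mul_zero]
  split_ifs with h
  · rw [Finset.sum_eq_single ⟨d, h⟩]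
    · simp
    · rintro j - hj
      exact if_neg fun h' => hj (Fin.ext h'.symm)
    · simp
  · exact Finset.sum_eq_zero fun j _ => if_neg fun (h' : d = j) => h (h' ▸ j.2)

theorem jetIdeal_singleton_le_iff (f : MvPolynomial σ k)
    (Q : Ideal (MvPolynomial (σ × Fin (s + 1)) k)) :
    jetIdeal k s {f} ≤ Q ↔
      Polynomial.X ^ (s + 1) ∣ (jetSub k s f).map (Ideal.Quotient.mk Q) := by
  rw [jetIdeal, Ideal.span_le, Polynomial.X_pow_dvd_iff]
  simp only [Polynomial.coeff_map, Ideal.Quotient.eq_zero_iff_mem]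
  constructor
  · intro h d hd
    exact h ⟨f, rfl, d, Nat.lt_succ_iff.mp hd, rfl⟩
  · rintro h _ ⟨_, rfl, d, hd, rfl⟩
    exact h d (Nat.lt_succ_iff.mpr hd)

theorem X_pow_dvd_map_jetSub_X_iff (i : σ) (q : ℕ)
    (Q : Ideal (MvPolynomial (σ × Fin (s + 1)) k)) :
    Polynomial.X ^ q ∣ (jetSub k s (X i)).map (Ideal.Quotient.mk Q) ↔
      ∀ j : Fin (s + 1), (j : ℕ) < q → X (i, j) ∈ Q := by
  rw [Polynomial.X_pow_dvd_iff]
  simp only [Polynomial.coeff_map, Ideal.Quotient.eq_zero_iff_mem, coeff_jetSub_X]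
  constructor
  · intro h j hj
    simpa [j.2] using h j hj
  · intro h d hd
    split_ifs with hds
    · exact h ⟨d, hds⟩ hd
    · exact Q.zero_mem

theorem map_jetSub_monomial [Fintype σ] (m : σ →₀ ℕ)
    (Q : Ideal (MvPolynomial (σ × Fin (s + 1)) k)) :
    (jetSub k s (monomial m 1)).map (Ideal.Quotient.mk Q) =
      ∏ i, (jetSub k s (X i)).map (Ideal.Quotient.mk Q) ^ m i := by
  rw [monomial_eq, map_one, one_mul, Finsupp.prod_fintype _ _ (fun _ => pow_zero _), map_prod,
    Polynomial.map_prod]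
  simp only [map_pow, Polynomial.map_pow]

/-- The ideal generated by the jet variables `x_{i,j}` with `j < p i`. -/
noncomputable def jetVarIdeal (k : Type*) [Field k] {σ : Type*} (s : ℕ) (p : σ → ℕ) :
    Ideal (MvPolynomial (σ × Fin (s + 1)) k) :=
  Ideal.span {g | ∃ i : σ, ∃ j : Fin (s + 1), (j : ℕ) < p i ∧ g = X (i, j)}

theorem jetVarIdeal_eq_span_X_image (p : σ → ℕ) :
    jetVarIdeal k s p = Ideal.span (X '' {v : σ × Fin (s + 1) | (v.2 : ℕ) < p v.1}) := by
  rw [jetVarIdeal]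
  congr 1
  ext g
  constructor
  · rintro ⟨i, j, h, rfl⟩
    exact ⟨(i, j), h, rfl⟩
  · rintro ⟨⟨i, j⟩, h, rfl⟩
    exact ⟨i, j, h, rfl⟩

theorem isPrime_jetVarIdeal (p : σ → ℕ) : (jetVarIdeal k s p).IsPrime := by
  rw [jetVarIdeal_eq_span_X_image]
  exact isPrime_span_X_image _

theorem jetVarIdeal_le_iff (p : σ → ℕ) (Q : Ideal (MvPolynomial (σ × Fin (s + 1)) k)) :
    jetVarIdeal k s p ≤ Q ↔ ∀ i, ∀ j : Fin (s + 1), (j : ℕ) < p i → X (i, j) ∈ Q := by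
  rw [jetVarIdeal, Ideal.span_le]
  constructor
  · exact fun h i j hj => h ⟨i, j, hj, rfl⟩
  · rintro h _ ⟨i, j, hj, rfl⟩
    exact h i j hj

theorem X_mem_jetVarIdeal_iff (p : σ → ℕ) (i : σ) (j : Fin (s + 1)) :
    X (i, j) ∈ jetVarIdeal k s p ↔ (j : ℕ) < p i := by
  rw [jetVarIdeal_eq_span_X_image, mem_ideal_span_X_image]
  constructor
  · intro h
    obtain ⟨v, hv, hne⟩ := h (Finsupp.single (i, j) 1) (by simp [support_X])
    rw [Finsupp.single_apply_ne_zero] at hne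
    rw [hne.1] at hv
    exact hv
  · intro h v hv
    rw [support_X, Finset.mem_singleton] at hv
    exact ⟨(i, j), h, by simp [hv]⟩

theorem le_of_jetVarIdeal_le {p q : σ → ℕ} (hp : ∀ i, p i ≤ s + 1)
    (h : jetVarIdeal k s p ≤ jetVarIdeal k s q) : p ≤ q := by
  intro i
  by_contra! hlt
  have := (jetVarIdeal_le_iff p _).mp h i ⟨q i, hlt.trans_le (hp i)⟩ hlt
  rw [X_mem_jetVarIdeal_iff] at this
  exact lt_irrefl _ this

variable [Fintype σ]

theorem jetIdeal_monomial_le_of_jetVarIdeal_le {m : σ →₀ ℕ} {p : σ → ℕ}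
    (hp : s + 1 ≤ ∑ i, m i * p i) {Q : Ideal (MvPolynomial (σ × Fin (s + 1)) k)}
    (h : jetVarIdeal k s p ≤ Q) : jetIdeal k s {monomial m (1 : k)} ≤ Q := by
  rw [jetIdeal_singleton_le_iff, map_jetSub_monomial]
  exact pow_dvd_prod_pow_of_forall_pow_dvd hp fun i =>
    (X_pow_dvd_map_jetSub_X_iff i (p i) Q).mpr ((jetVarIdeal_le_iff p Q).mp h i)

theorem exists_minimal_jetVarIdeal_le {m : σ →₀ ℕ}
    {Q : Ideal (MvPolynomial (σ × Fin (s + 1)) k)} (hQ : Q.IsPrime)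
    (h : jetIdeal k s {monomial m (1 : k)} ≤ Q) :
    ∃ p : σ → ℕ, Minimal (fun p => s + 1 ≤ ∑ i, m i * p i) p ∧ jetVarIdeal k s p ≤ Q := by
  rw [jetIdeal_singleton_le_iff, map_jetSub_monomial] at h
  obtain ⟨p, hp, hdvd⟩ := Polynomial.prime_X.exists_pow_dvd_of_pow_dvd_prod_pow h
  obtain ⟨q, hqp, hq⟩ :=
    exists_minimal_le_of_wellFoundedLT (fun p : σ → ℕ => s + 1 ≤ ∑ i, m i * p i) p hp
  exact ⟨q, hq, (jetVarIdeal_le_iff q Q).mpr fun i j hj =>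
    (X_pow_dvd_map_jetSub_X_iff i (p i) Q).mp (hdvd i) j (hj.trans_le (hqp i))⟩

theorem le_of_minimal_le_sum_mul {m : σ → ℕ} {N : ℕ} {p : σ → ℕ}
    (hp : Minimal (fun p : σ → ℕ => N ≤ ∑ i, m i * p i) p) (i : σ) : p i ≤ N := by
  have hq : N ≤ ∑ i, m i * min (p i) N := by
    by_cases h : ∃ i, m i ≠ 0 ∧ N ≤ p i
    · obtain ⟨i, hi, hN⟩ := h
      refine le_trans ?_ (Finset.single_le_sum (fun _ _ => Nat.zero_le _) (Finset.mem_univ i))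
      rw [min_eq_right hN]
      exact Nat.le_mul_of_pos_left N (Nat.pos_of_ne_zero hi)
    · push Not at h
      refine hp.prop.trans_eq (Finset.sum_congr rfl fun i _ => ?_)
      by_cases hi : m i = 0
      · simp [hi]
      · rw [min_eq_left (h i hi).le]
  exact (hp.le_of_le (y := fun i => min (p i) N) hq (fun i => min_le_left _ _) i).trans
    (min_le_right _ _)

end Jets

/-- in characteristic zero, for a nonconstant monomial
`f = x_1^{m_1} ⋯ x_n^{m_n}` and `I = ⟨f⟩`, the minimal primes of `J_s(I)` are exactly the
ideals `P_p = ⟨x_{i,j} : 0 ≤ j ≤ p_i - 1⟩` where `p` ranges over the tuples of nonnegative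
integers with `Σ m_i p_i ≥ s + 1` that are minimal (componentwise) with this property. -/
theorem minimalPrimes_jets_monomial_hypersurface (k : Type*) [Field k] [CharZero k]
    (n s : ℕ) (hn : 1 ≤ n) (m : Fin n →₀ ℕ) (hm : m ≠ 0) :
    (jetIdeal k s {MvPolynomial.monomial m (1 : k)}).minimalPrimes =
      {P | ∃ p : Fin n → ℕ,
        s + 1 ≤ ∑ i, m i * p i ∧
        (∀ q : Fin n → ℕ, s + 1 ≤ ∑ i, m i * q i → (∀ i, q i ≤ p i) → q = p) ∧
        P = Ideal.span
          {g | ∃ i : Fin n, ∃ j : Fin (s + 1), (j : ℕ) < p i ∧ g = MvPolynomial.X (i, j)}} := by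
  have hmin (p : Fin n → ℕ) : Minimal (fun p : Fin n → ℕ => s + 1 ≤ ∑ i, m i * p i) p ↔
      s + 1 ≤ ∑ i, m i * p i ∧
        ∀ q : Fin n → ℕ, s + 1 ≤ ∑ i, m i * q i → (∀ i, q i ≤ p i) → q = p := by
    rw [minimal_iff]
    exact and_congr_right fun _ =>
      forall_congr' fun q => forall_congr' fun _ => forall_congr' fun _ => eq_comm
  ext P
  constructor
  · rintro ⟨⟨hP, hJP⟩, hPmin⟩
    obtain ⟨p, hp, hpP⟩ := exists_minimal_jetVarIdeal_le hP hJP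
    obtain ⟨hp₁, hp₂⟩ := (hmin p).mp hp
    exact ⟨p, hp₁, hp₂, le_antisymm
      (hPmin ⟨isPrime_jetVarIdeal p, jetIdeal_monomial_le_of_jetVarIdeal_le hp₁ le_rfl⟩ hpP) hpP⟩
  · rintro ⟨p, hp₁, hp₂, rfl⟩
    change jetVarIdeal k s p ∈ _
    refine ⟨⟨isPrime_jetVarIdeal p, jetIdeal_monomial_le_of_jetVarIdeal_le hp₁ le_rfl⟩, ?_⟩
    rintro Q ⟨hQ, hJQ⟩ hQp
    obtain ⟨q, hq, hqQ⟩ := exists_minimal_jetVarIdeal_le hQ hJQ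
    have hqp : q ≤ p := le_of_jetVarIdeal_le (le_of_minimal_le_sum_mul hq) (hqQ.trans hQp)
    rwa [hp₂ q hq.prop hqp] at hqQ
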